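/- arXiv:1908.01327 — 3 statements merged into one kernel-verified Lean document; each statement's English description precedes it below -/
import Mathlib

section
/- Identity for averaged local energies: for any p, q ∈ W, F(q) − (1/N_c) Σ_{k=1}^{N_c} F_k(R_k p; q) = −(1/N_c)⟨∇F(q), p − q⟩ − (1/N_c) D(p, q), where D(p, q) = Σ_{k=1}^{N_c} (1/2)‖div R_k* R_k (p − q)‖₂². -/
open Finset

noncomputable section

/-- The discrete image domain of `M × N` pixels. -/
abbrev Idx (M N : ℕ) := Fin M × Fin N

/-- The discrete divergence operator `div : W → V`, the negative adjoint of
the discrete gradient. -/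
def divOp {M N : ℕ} (p : Idx M N → ℝ × ℝ) : Idx M N → ℝ := fun x =>
  ((if (x.1 : ℕ) + 1 < M then (p x).1 else 0)
    - (if 1 ≤ (x.1 : ℕ) then
        (p (⟨(x.1 : ℕ) - 1, lt_of_le_of_lt (Nat.sub_le _ _) x.1.isLt⟩, x.2)).1 else 0))
  + ((if (x.2 : ℕ) + 1 < N then (p x).2 else 0)
    - (if 1 ≤ (x.2 : ℕ) then
        (p (x.1, ⟨(x.2 : ℕ) - 1, lt_of_le_of_lt (Nat.sub_le _ _) x.2.isLt⟩)).2 else 0))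

/-- The discrete gradient operator `∇ : V → W`. -/
def gradOp {M N : ℕ} (u : Idx M N → ℝ) : Idx M N → ℝ × ℝ := fun x =>
  ((if h : (x.1 : ℕ) + 1 < M then u (⟨(x.1 : ℕ) + 1, h⟩, x.2) - u x else 0),
   (if h : (x.2 : ℕ) + 1 < N then u (x.1, ⟨(x.2 : ℕ) + 1, h⟩) - u x else 0))

/-- Euclidean inner product on `V`. -/
def innerV {M N : ℕ} (u v : Idx M N → ℝ) : ℝ := ∑ x, u x * v x

/-- Euclidean inner product on `W`. -/
def innerW {M N : ℕ} (p q : Idx M N → ℝ × ℝ) : ℝ :=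
  ∑ x, ((p x).1 * (q x).1 + (p x).2 * (q x).2)

/-- Squared Euclidean norm on `V`. -/
def normVsq {M N : ℕ} (u : Idx M N → ℝ) : ℝ := ∑ x, (u x) ^ 2

/-- Max (Euclidean-pointwise) norm on `W`. -/
def normWinf {M N : ℕ} (p : Idx M N → ℝ × ℝ) : ℝ :=
  ⨆ x : Idx M N, Real.sqrt ((p x).1 ^ 2 + (p x).2 ^ 2)

/-- The dual ROF energy `F(p) = (1/2)‖div p + α f‖₂²`. -/
def F {M N : ℕ} (α : ℝ) (f : Idx M N → ℝ) (p : Idx M N → ℝ × ℝ) : ℝ :=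
  (1 / 2) * normVsq (fun x => divOp p x + α * f x)

/-- The gradient of `F`, namely `∇F(q) = div*(div q + α f) = -∇(div q + α f)`. -/
def gradF {M N : ℕ} (α : ℝ) (f : Idx M N → ℝ) (q : Idx M N → ℝ × ℝ) :
    Idx M N → ℝ × ℝ :=
  fun x => - gradOp (fun y => divOp q y + α * f y) x

/-- The constraint set `C = {p ∈ W : |p_{ij}| ≤ 1 ∀ (i,j)}`. -/
def Cset (M N : ℕ) : Set (Idx M N → ℝ × ℝ) :=
  {p | ∀ x, Real.sqrt ((p x).1 ^ 2 + (p x).2 ^ 2) ≤ 1}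

/-- Restriction operator `R_k : W → W_k`. -/
def Rk {M N : ℕ} (S : Finset (Idx M N)) (p : Idx M N → ℝ × ℝ) :
    {x // x ∈ S} → ℝ × ℝ :=
  fun x => p x.1

/-- Extension-by-zero operator `R_k* : W_k → W`. -/
def Ek {M N : ℕ} (S : Finset (Idx M N)) (pk : {x // x ∈ S} → ℝ × ℝ) :
    Idx M N → ℝ × ℝ :=
  fun x => if h : x ∈ S then pk ⟨x, h⟩ else 0

/-- The orthogonal projection `R_k* R_k : W → W`. -/
def projk {M N : ℕ} (S : Finset (Idx M N)) (p : Idx M N → ℝ × ℝ) :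
    Idx M N → ℝ × ℝ :=
  fun x => if x ∈ S then p x else 0

/-- The local constraint set `C_k = R_k C`. -/
def Ck {M N : ℕ} (S : Finset (Idx M N)) : Set ({x // x ∈ S} → ℝ × ℝ) :=
  Rk S '' Cset M N

/-- The local energy `F_k(p_k; r) = F(R_k* p_k + (I - R_k* R_k) r)`. -/
def Fk {M N : ℕ} (α : ℝ) (f : Idx M N → ℝ) (S : Finset (Idx M N))
    (pk : {x // x ∈ S} → ℝ × ℝ) (r : Idx M N → ℝ × ℝ) : ℝ :=
  F α f (Ek S pk + (r - projk S r))

/-- Euclidean inner product on `W_k`. -/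
def innerWk {M N : ℕ} (S : Finset (Idx M N)) (pk qk : {x // x ∈ S} → ℝ × ℝ) : ℝ :=
  ∑ x : {x // x ∈ S}, ((pk x).1 * (qk x).1 + (pk x).2 * (qk x).2)

/-- The distance-like quantity `D(p,q) = Σ_k (1/2)‖div R_k* R_k (p - q)‖₂²`. -/
def Ddist {M N Nc : ℕ} (S : Fin Nc → Finset (Idx M N))
    (p q : Idx M N → ℝ × ℝ) : ℝ :=
  ∑ k, (1 / 2) * normVsq (divOp (projk (S k) (p - q)))

/-- The rectangular subdomain `Ω_s` of size `m × n` indexed by `s : Fin Ms × Fin Ns`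
(for an `M × N` image with `M = Ms * m`, `N = Ns * n`). -/
def block {M N Ms Ns : ℕ} (m n : ℕ) (s : Fin Ms × Fin Ns) : Finset (Idx M N) :=
  Finset.univ.filter fun x => (x.1 : ℕ) / m = (s.1 : ℕ) ∧ (x.2 : ℕ) / n = (s.2 : ℕ)

end

theorem divOp_add {M N : ℕ} (p q : Idx M N → ℝ × ℝ) :
    divOp (p + q) = divOp p + divOp q := by
  funext x
  simp only [divOp, Pi.add_apply, Prod.fst_add, Prod.snd_add]
  split_ifs <;> ring

/-- Summation by parts for forward differences on `Fin n`. -/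
theorem sum_mul_backward_diff {n : ℕ} (u w : Fin n → ℝ) :
    ∑ i : Fin n, u i * ((if (i : ℕ) + 1 < n then w i else 0)
        - (if 1 ≤ (i : ℕ) then
            w ⟨(i : ℕ) - 1, lt_of_le_of_lt (Nat.sub_le _ _) i.isLt⟩ else 0))
      = -∑ i : Fin n, (if h : (i : ℕ) + 1 < n then u ⟨(i : ℕ) + 1, h⟩ - u i else 0) * w i := by
  cases n with
  | zero => simp
  | succ m =>
    have hleft : ∑ i : Fin (m + 1), u i * (if (i : ℕ) + 1 < m + 1 then w i else 0)
        = ∑ i : Fin m, u i.castSucc * w i.castSucc := by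
      simp [Fin.sum_univ_castSucc]
    have hshift : ∑ i : Fin (m + 1), u i * (if 1 ≤ (i : ℕ) then
          w ⟨(i : ℕ) - 1, lt_of_le_of_lt (Nat.sub_le _ _) i.isLt⟩ else 0)
        = ∑ i : Fin m, u i.succ * w i.castSucc := by
      rw [Fin.sum_univ_succ]
      simp [Fin.castSucc, Fin.castAdd, Fin.castLE]
    have hright : ∑ i : Fin (m + 1),
          (if h : (i : ℕ) + 1 < m + 1 then u ⟨(i : ℕ) + 1, h⟩ - u i else 0) * w i
        = ∑ i : Fin m, (u i.succ - u i.castSucc) * w i.castSucc := by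
      rw [Fin.sum_univ_castSucc]
      simp [Fin.succ]
    simp only [mul_sub, sum_sub_distrib, hleft, hshift, hright, sub_mul]
    ring

/-- The divergence is the negative adjoint of the gradient. -/
theorem innerV_divOp {M N : ℕ} (u : Idx M N → ℝ) (p : Idx M N → ℝ × ℝ) :
    innerV u (divOp p) = -innerW (gradOp u) p := by
  simp only [innerV, innerW, divOp, gradOp, mul_add, sum_add_distrib, neg_add]
  congr 1
  · rw [Fintype.sum_prod_type_right, Fintype.sum_prod_type_right, ← sum_neg_distrib]
    exact sum_congr rfl fun j _ =>
      sum_mul_backward_diff (fun i => u (i, j)) (fun i => (p (i, j)).1)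
  · rw [Fintype.sum_prod_type, Fintype.sum_prod_type, ← sum_neg_distrib]
    exact sum_congr rfl fun i _ =>
      sum_mul_backward_diff (fun j => u (i, j)) (fun j => (p (i, j)).2)

/-- The exact second-order expansion of the quadratic energy `F`. -/
theorem F_add {M N : ℕ} (α : ℝ) (f : Idx M N → ℝ) (q v : Idx M N → ℝ × ℝ) :
    F α f (q + v) = F α f q + innerW (gradF α f q) v + (1 / 2) * normVsq (divOp v) := by
  have hgrad : innerW (gradF α f q) v = innerV (fun x => divOp q x + α * f x) (divOp v) := by
    rw [innerV_divOp]
    simp only [innerW, gradF, Prod.fst_neg, Prod.snd_neg, ← sum_neg_distrib]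
    exact sum_congr rfl fun x _ => by ring
  rw [hgrad]
  simp only [F, normVsq, innerV, divOp_add, Pi.add_apply, mul_sum, ← sum_add_distrib]
  exact sum_congr rfl fun x _ => by ring

theorem Fk_Rk {M N : ℕ} (α : ℝ) (f : Idx M N → ℝ) (S : Finset (Idx M N))
    (p q : Idx M N → ℝ × ℝ) :
    Fk α f S (Rk S p) q = F α f (q + projk S (p - q)) := by
  unfold Fk
  congr 1
  funext x
  by_cases hx : x ∈ S <;> simp [Ek, Rk, projk, hx]

/-- The inner product on `W` decomposes along a partition of the domain. -/
theorem sum_innerW_projk {M N Nc : ℕ} (S : Fin Nc → Finset (Idx M N))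
    (hdisj : ∀ k l, k ≠ l → Disjoint (S k) (S l))
    (hcover : ∀ x : Idx M N, ∃ k, x ∈ S k) (g v : Idx M N → ℝ × ℝ) :
    ∑ k, innerW g (projk (S k) v) = innerW g v := by
  simp only [innerW]
  rw [sum_comm]
  refine sum_congr rfl fun x _ => ?_
  obtain ⟨k, hk⟩ := hcover x
  rw [sum_eq_single k]
  · simp [projk, hk]
  · intro l _ hl
    have hx : x ∉ S l := disjoint_left.mp (hdisj k l hl.symm) hk
    simp [projk, hx]
  · simp

theorem averaged_local_energy_identity (M N : ℕ) (α : ℝ) (hα : 0 < α) (f : Idx M N → ℝ)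
    (Nc : ℕ) (S : Fin Nc → Finset (Idx M N))
    (hdisj : ∀ k l, k ≠ l → Disjoint (S k) (S l))
    (hcover : ∀ x : Idx M N, ∃ k, x ∈ S k)
    (p q : Idx M N → ℝ × ℝ) :
    F α f q - (1 / (Nc : ℝ)) * ∑ k, Fk α f (S k) (Rk (S k) p) q
      = -(1 / (Nc : ℝ)) * innerW (gradF α f q) (p - q)
        - (1 / (Nc : ℝ)) * Ddist S p q := by
  have hsum : ∑ k, Fk α f (S k) (Rk (S k) p) q
      = Nc * F α f q + innerW (gradF α f q) (p - q) + Ddist S p q := by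
    simp only [Fk_Rk, F_add, sum_add_distrib, sum_innerW_projk S hdisj hcover, Ddist]
    simp
  rw [hsum]
  rcases Nat.eq_zero_or_pos Nc with rfl | hNc
  · have hempty : IsEmpty (Idx M N) := ⟨fun x => (hcover x).choose.elim0⟩
    simp [F, normVsq]
  · have hNc' : (Nc : ℝ) ≠ 0 := by exact_mod_cast hNc.ne'
    field_simp
    ring
end

section
/- Fundamental inequality for the relaxed block Jacobi step: for any p, q ∈ C, if for each k the element s_k ∈ C_k minimizes F_k(·; q) over C_k, S̄_k(q) = R_k* s_k + (I − R_k* R_k) q, and S(q) = (1/N_c) Σ_{k=1}^{N_c} S̄_k(q), then (1/N_c) F(p) + (1 − 1/N_c) F(q) − F(S(q)) ≥ D(p, S(q)) − D(p, q). -/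
open Finset

/-- The discrete divergence as a linear map. -/
def divLin (M N : ℕ) : (Idx M N → ℝ × ℝ) →ₗ[ℝ] (Idx M N → ℝ) where
  toFun := divOp
  map_add' p q := by
    funext x
    simp only [divOp, Pi.add_apply, Prod.fst_add, Prod.snd_add]
    split_ifs <;> ring
  map_smul' c p := by
    funext x
    simp only [divOp, Pi.smul_apply, Prod.smul_fst, Prod.smul_snd, smul_eq_mul, RingHom.id_apply]
    split_ifs <;> ring

theorem divOp_eq_divLin {M N : ℕ} (p : Idx M N → ℝ × ℝ) : divOp p = divLin M N p := rfl

theorem convex_Cset (M N : ℕ) : Convex ℝ (Cset M N) := by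
  intro p hp q hq a b ha hb hab x
  have h1 := hp x
  have h2 := hq x
  rw [Real.sqrt_le_one] at *
  simp only [Pi.add_apply, Pi.smul_apply, Prod.fst_add, Prod.snd_add, Prod.smul_fst,
    Prod.smul_snd, smul_eq_mul]
  obtain rfl : b = 1 - a := by linarith
  nlinarith [mul_nonneg (mul_nonneg ha hb) (sq_nonneg ((p x).1 - (q x).1)),
    mul_nonneg (mul_nonneg ha hb) (sq_nonneg ((p x).2 - (q x).2)),
    mul_le_mul_of_nonneg_left h1 ha, mul_le_mul_of_nonneg_left h2 hb]

theorem nonneg_of_forall_mul_add_sq_nonneg {b c : ℝ}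
    (h : ∀ t : ℝ, 0 < t → t ≤ 1 → 0 ≤ t * b + t ^ 2 * c) : 0 ≤ b := by
  by_contra! hb
  have hb0 : 0 < |b| := abs_pos.2 hb.ne
  have hbb : |b| = -b := abs_of_neg hb
  set t := |b| / (2 * (|c| + |b|)) with ht
  have ht0 : 0 < t := by positivity
  have ht1 : t ≤ 1 := by
    rw [ht, div_le_one (by positivity)]
    linarith [abs_nonneg c, abs_nonneg b]
  have htc : t * (2 * (|c| + |b|)) = |b| := div_mul_cancel₀ _ (by positivity)
  have h1 := h t ht0 ht1
  have h2 : 0 ≤ b + t * c := by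
    by_contra! hneg
    nlinarith [mul_neg_of_pos_of_neg ht0 hneg]
  have h3 : t * c ≤ t * |c| := mul_le_mul_of_nonneg_left (le_abs_self c) ht0.le
  nlinarith [mul_pos ht0 hb0]

/-- First-order optimality for a least-squares energy along a segment. -/
theorem sum_mul_nonneg_of_forall_normVsq_le {M N : ℕ} {h c : Idx M N → ℝ}
    (hmin : ∀ t : ℝ, 0 < t → t ≤ 1 → normVsq h ≤ normVsq (h + t • c)) :
    0 ≤ ∑ x, h x * c x := by
  have key : 0 ≤ 2 * ∑ x, h x * c x := by
    refine nonneg_of_forall_mul_add_sq_nonneg (c := normVsq c) fun t h0 h1 => ?_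
    have hle := hmin t h0 h1
    have expand : normVsq (h + t • c)
        = normVsq h + (t * (2 * ∑ x, h x * c x) + t ^ 2 * normVsq c) := by
      simp only [normVsq, Finset.mul_sum, ← Finset.sum_add_distrib]
      refine Finset.sum_congr rfl fun x _ => ?_
      simp only [Pi.add_apply, Pi.smul_apply, smul_eq_mul]
      ring
    linarith
  linarith

theorem Ek_add_smul_sub {M N : ℕ} (S : Finset (Idx M N)) (r : {x // x ∈ S} → ℝ × ℝ)
    (p q : Idx M N → ℝ × ℝ) (t : ℝ) :
    Ek S ((1 - t) • r + t • Rk S p) + (q - projk S q)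
      = q + (Ek S r - projk S q) + t • (projk S (p - q) - (Ek S r - projk S q)) := by
  funext x
  by_cases hx : x ∈ S
  · simp only [Ek, projk, Rk, hx, Pi.add_apply, Pi.sub_apply, Pi.smul_apply, dif_pos, if_true]
    module
  · simp [Ek, projk, hx]

theorem sum_projk {M N Nc : ℕ} {S : Fin Nc → Finset (Idx M N)}
    (hdisj : ∀ k l, k ≠ l → Disjoint (S k) (S l)) (hcover : ∀ x : Idx M N, ∃ k, x ∈ S k)
    (p : Idx M N → ℝ × ℝ) : ∑ k, projk (S k) p = p := by
  funext x
  obtain ⟨k, hk⟩ := hcover x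
  rw [Finset.sum_apply, Finset.sum_eq_single k]
  · simp [projk, hk]
  · intro l _ hl
    simp [projk, Finset.disjoint_left.1 (hdisj k l hl.symm) hk]
  · simp

/-- The variational inequality satisfied by a minimizer of a local energy. -/
theorem variational_inequality_of_forall_Fk_le {M N : ℕ} {α : ℝ} {f : Idx M N → ℝ}
    {S : Finset (Idx M N)} {p q : Idx M N → ℝ × ℝ} {r : {x // x ∈ S} → ℝ × ℝ}
    (hp : p ∈ Cset M N) (hr : r ∈ Ck S)
    (hmin : ∀ rk ∈ Ck S, Fk α f S r q ≤ Fk α f S rk q) :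
    0 ≤ ∑ x, ((divOp q x + α * f x) + divOp (Ek S r - projk S q) x)
      * (divOp (projk S (p - q)) x - divOp (Ek S r - projk S q) x) := by
  refine sum_mul_nonneg_of_forall_normVsq_le
    (h := fun x => (divOp q x + α * f x) + divOp (Ek S r - projk S q) x)
    (c := fun x => divOp (projk S (p - q)) x - divOp (Ek S r - projk S q) x)
    fun t h0 h1 => ?_
  have hmem : (1 - t) • r + t • Rk S p ∈ Ck S := by
    obtain ⟨z, hz, rfl⟩ := hr
    exact ⟨(1 - t) • z + t • p,
      convex_Cset M N hz hp (by linarith) h0.le (by ring), rfl⟩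
  have hle := hmin _ hmem
  have h0r : Ek S r + (q - projk S q) = q + (Ek S r - projk S q) := by abel
  simp only [Fk, F] at hle
  rw [h0r, Ek_add_smul_sub] at hle
  have hle' := le_of_mul_le_mul_left hle (by norm_num : (0 : ℝ) < 1 / 2)
  refine (congrArg normVsq ?_).le.trans (hle'.trans (congrArg normVsq ?_).le)
  · funext x
    simp only [divOp_eq_divLin, map_add, Pi.add_apply]
    ring
  · funext x
    simp only [divOp_eq_divLin, map_add, map_sub, map_smul, Pi.add_apply, Pi.sub_apply,
      Pi.smul_apply, smul_eq_mul]
    ring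

/-- The scalar inequality behind one relaxed block Jacobi step. -/
theorem relaxed_step_pointwise {n : ℕ} (hn : 0 < n) (g : ℝ) (a b : Fin n → ℝ) :
    (1 / (n : ℝ)) * ∑ k, (g + a k) * (b k - a k)
      ≤ (1 / (n : ℝ)) * (1 / 2 * (g + ∑ k, b k) ^ 2) + (1 - 1 / (n : ℝ)) * (1 / 2 * g ^ 2)
        - 1 / 2 * (g + (1 / (n : ℝ)) * ∑ k, a k) ^ 2
        - (∑ k, 1 / 2 * (b k - (1 / (n : ℝ)) * a k) ^ 2 - ∑ k, 1 / 2 * b k ^ 2) := by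
  have hn1 : (1 : ℝ) ≤ n := by exact_mod_cast hn
  have hcs : (∑ k, a k) ^ 2 ≤ n * ∑ k, a k ^ 2 := by
    simpa using sq_sum_le_card_mul_sum_sq (s := Finset.univ) (f := a)
  have hQ : 0 ≤ ∑ k, a k ^ 2 := Finset.sum_nonneg fun k _ => sq_nonneg _
  set c := 1 / (n : ℝ) with hc
  have hc0 : 0 < c := by positivity
  have hc1 : c ≤ 1 := by rw [hc, div_le_one (by positivity)]; exact hn1
  have hcn : c * n = 1 := by rw [hc]; field_simp
  have e1 : ∑ k, (g + a k) * (b k - a k)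
      = g * ∑ k, b k - g * ∑ k, a k + ∑ k, a k * b k - ∑ k, a k ^ 2 := by
    simp only [Finset.mul_sum, ← Finset.sum_sub_distrib, ← Finset.sum_add_distrib]
    exact Finset.sum_congr rfl fun k _ => by ring
  have e2 : ∑ k, 1 / 2 * (b k - c * a k) ^ 2 - ∑ k, 1 / 2 * b k ^ 2
      = c ^ 2 / 2 * ∑ k, a k ^ 2 - c * ∑ k, a k * b k := by
    simp only [Finset.mul_sum, ← Finset.sum_sub_distrib]
    exact Finset.sum_congr rfl fun k _ => by ring
  rw [e1, e2]
  have h1 : c ^ 2 * (∑ k, a k) ^ 2 ≤ c * ∑ k, a k ^ 2 := by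
    calc c ^ 2 * (∑ k, a k) ^ 2 ≤ c ^ 2 * (n * ∑ k, a k ^ 2) := by gcongr
      _ = c * (c * n) * ∑ k, a k ^ 2 := by ring
      _ = c * ∑ k, a k ^ 2 := by rw [hcn, mul_one]
  have h2 : c ^ 2 * ∑ k, a k ^ 2 ≤ c * ∑ k, a k ^ 2 := by
    gcongr
    nlinarith
  have h3 : 0 ≤ c * (∑ k, b k) ^ 2 := by positivity
  linarith

theorem relaxed_jacobi_fundamental (M N : ℕ) (α : ℝ) (hα : 0 < α) (f : Idx M N → ℝ)
    (Nc : ℕ) (S : Fin Nc → Finset (Idx M N))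
    (hdisj : ∀ k l, k ≠ l → Disjoint (S k) (S l))
    (hcover : ∀ x : Idx M N, ∃ k, x ∈ S k)
    (p q : Idx M N → ℝ × ℝ) (hp : p ∈ Cset M N) (hq : q ∈ Cset M N)
    (s : ∀ k : Fin Nc, {x // x ∈ S k} → ℝ × ℝ)
    (hs : ∀ k, s k ∈ Ck (S k))
    (hmin : ∀ k, ∀ rk ∈ Ck (S k), Fk α f (S k) (s k) q ≤ Fk α f (S k) rk q) :
    (1 / (Nc : ℝ)) * F α f p + (1 - 1 / (Nc : ℝ)) * F α f q
        - F α f ((1 / (Nc : ℝ)) • ∑ k, (Ek (S k) (s k) + (q - projk (S k) q)))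
      ≥ Ddist S p ((1 / (Nc : ℝ)) • ∑ k, (Ek (S k) (s k) + (q - projk (S k) q)))
        - Ddist S p q := by
  rcases Nat.eq_zero_or_pos Nc with rfl | hn
  · have : IsEmpty (Idx M N) := ⟨fun x => (hcover x).choose.elim0⟩
    simp [F, normVsq, Ddist]
  set c := 1 / (Nc : ℝ) with hc
  have hcn : c * Nc = 1 := by
    rw [hc]
    field_simp
  let e : Fin Nc → Idx M N → ℝ × ℝ := fun k => Ek (S k) (s k) - projk (S k) q
  have hstep : c • ∑ k, (Ek (S k) (s k) + (q - projk (S k) q)) = q + c • ∑ k, e k := by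
    have hk : ∀ k, Ek (S k) (s k) + (q - projk (S k) q) = q + e k := fun k => by
      simp only [e]
      abel
    simp only [hk, Finset.sum_add_distrib, Finset.sum_const, Finset.card_univ, Fintype.card_fin,
      smul_add, ← Nat.cast_smul_eq_nsmul ℝ, smul_smul, hcn, one_smul]
  rw [hstep]
  have hproj : ∀ k, projk (S k) (p - (q + c • ∑ l, e l)) = projk (S k) (p - q) - c • e k := by
    intro k
    funext x
    by_cases hx : x ∈ S k
    · have hsum : (∑ l, e l) x = e k x := by
        rw [Finset.sum_apply, Finset.sum_eq_single k]
        · intro l _ hl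
          simp [e, Ek, projk, Finset.disjoint_left.1 (hdisj k l hl.symm) hx]
        · simp
      simp only [projk, hx, if_true, Pi.sub_apply, Pi.add_apply, Pi.smul_apply, hsum]
      abel
    · simp [projk, Ek, e, hx]
  have hvi : 0 ≤ c * ∑ k, ∑ x, ((divOp q x + α * f x) + divOp (e k) x)
      * (divOp (projk (S k) (p - q)) x - divOp (e k) x) :=
    mul_nonneg (by positivity) <| Finset.sum_nonneg fun k _ =>
      variational_inequality_of_forall_Fk_le hp (hs k) (hmin k)
  have hdp : ∀ x, divOp p x + α * f x
      = (divOp q x + α * f x) + ∑ k, divOp (projk (S k) (p - q)) x := by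
    intro x
    have h := congrFun (congrArg divOp (sum_projk hdisj hcover (p - q))) x
    simp only [divOp_eq_divLin, map_sum, map_sub, Finset.sum_apply, Pi.sub_apply] at h ⊢
    linarith
  have hds : ∀ x, divOp (q + c • ∑ k, e k) x + α * f x
      = (divOp q x + α * f x) + c * ∑ k, divOp (e k) x := by
    intro x
    simp only [divOp_eq_divLin, map_add, map_smul, map_sum, Pi.add_apply, Pi.smul_apply,
      Finset.sum_apply, smul_eq_mul]
    ring
  have hdd : ∀ k x, divOp (projk (S k) (p - q) - c • e k) x
      = divOp (projk (S k) (p - q)) x - c * divOp (e k) x := by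
    intro k x
    simp only [divOp_eq_divLin, map_sub, map_smul, Pi.sub_apply, Pi.smul_apply, smul_eq_mul]
  have hpt := Finset.sum_le_sum fun x (_ : x ∈ (Finset.univ : Finset (Idx M N))) =>
    relaxed_step_pointwise hn (divOp q x + α * f x) (fun k => divOp (e k) x)
      (fun k => divOp (projk (S k) (p - q)) x)
  rw [← hc] at hpt
  simp only [Finset.sum_sub_distrib, Finset.sum_add_distrib, ← Finset.mul_sum] at hpt
  rw [Finset.sum_comm] at hvi
  simp only [F, normVsq, Ddist, hproj, hdp, hds, hdd, ← Finset.mul_sum]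
  rw [Finset.sum_comm (f := fun k x => (divOp (projk (S k) (p - q)) x - c * divOp (e k) x) ^ 2),
    Finset.sum_comm (f := fun k x => divOp (projk (S k) (p - q)) x ^ 2)]
  linarith
end

section
/- Monotone energy decrease of the relaxed block Jacobi method: if p⁽⁰⁾ ∈ C and for each n, p⁽ⁿ⁺¹⁾ = (1/N_c) Σ_{k=1}^{N_c} S̄_k(p⁽ⁿ⁾), where S̄_k(q) = R_k* s_k + (I − R_k* R_k) q with s_k ∈ C_k any minimizer of F_k(·; q) over C_k, then F(p⁽ⁿ⁾) − F(p⁽ⁿ⁺¹⁾) ≥ D(p⁽ⁿ⁾, p⁽ⁿ⁺¹⁾) ≥ 0 for every n ≥ 0; in particular the sequence {F(p⁽ⁿ⁾)} is nonincreasing. -/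
open Finset

theorem divOp_smul {M N : ℕ} (c : ℝ) (p : Idx M N → ℝ × ℝ) : divOp (c • p) = c • divOp p :=
  (divLin M N).map_smul c p

theorem divOp_sum {M N : ℕ} {ι : Type*} (t : Finset ι) (p : ι → Idx M N → ℝ × ℝ) :
    divOp (∑ k ∈ t, p k) = ∑ k ∈ t, divOp (p k) :=
  map_sum (divLin M N) p t

theorem normVsq_nonneg {M N : ℕ} (u : Idx M N → ℝ) : 0 ≤ normVsq u :=
  Finset.sum_nonneg fun _ _ => sq_nonneg _

theorem normVsq_smul {M N : ℕ} (c : ℝ) (u : Idx M N → ℝ) :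
    normVsq (c • u) = c ^ 2 * normVsq u := by
  simp only [normVsq, Pi.smul_apply, smul_eq_mul, mul_pow, Finset.mul_sum]

theorem F_add_smul {M N : ℕ} (α : ℝ) (f : Idx M N → ℝ) (q d : Idx M N → ℝ × ℝ) (t : ℝ) :
    F α f (q + t • d) = F α f q + t * innerV (fun x => divOp q x + α * f x) (divOp d)
      + t ^ 2 / 2 * normVsq (divOp d) := by
  simp only [F, normVsq, innerV, divOp_add, divOp_smul, Finset.mul_sum,
    ← Finset.sum_add_distrib, Pi.add_apply, Pi.smul_apply, smul_eq_mul]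
  exact Finset.sum_congr rfl fun x _ => by ring

/-- If `q` minimizes `F` along the segment from `q` to `q + d`, then `F` grows at least
quadratically along it. -/
theorem F_add_half_normVsq_le {M N : ℕ} (α : ℝ) (f : Idx M N → ℝ) (q d : Idx M N → ℝ × ℝ)
    (h : ∀ t : ℝ, 0 ≤ t → t ≤ 1 → F α f q ≤ F α f (q + t • d)) :
    F α f q + 1 / 2 * normVsq (divOp d) ≤ F α f (q + d) := by
  have key : 0 ≤ innerV (fun x => divOp q x + α * f x) (divOp d) := by
    by_contra! hneg
    set i := innerV (fun x => divOp q x + α * f x) (divOp d) with hi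
    set n := normVsq (divOp d) with hn
    have hn0 : 0 ≤ n := normVsq_nonneg _
    have hpos : 0 < n - i := by linarith
    have ht0 : 0 < -i / (n - i) := by apply div_pos <;> linarith
    have ht1 : -i / (n - i) ≤ 1 := by rw [div_le_one hpos]; linarith
    have h1 := h _ ht0.le ht1
    rw [F_add_smul, ← hi, ← hn] at h1
    set t := -i / (n - i) with ht
    have hmul : t * (n - i) = -i := div_mul_cancel₀ _ hpos.ne'
    have h2 : 0 ≤ t * (i + t / 2 * n) := by nlinarith
    have h3 := nonneg_of_mul_nonneg_right h2 ht0
    nlinarith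
  have h1 := F_add_smul α f q d 1
  rw [one_smul] at h1
  linarith

theorem Ek_add_sub_projk_mem_Cset {M N : ℕ} (S : Finset (Idx M N)) {q : Idx M N → ℝ × ℝ}
    (hq : q ∈ Cset M N) {r : {x // x ∈ S} → ℝ × ℝ} (hr : r ∈ Ck S) :
    Ek S r + (q - projk S q) ∈ Cset M N := by
  obtain ⟨w, hw, rfl⟩ := hr
  intro x
  by_cases hx : x ∈ S
  · simpa [Ek, projk, Rk, hx] using hw x
  · simpa [Ek, projk, Rk, hx] using hq x

/-- Jensen's inequality for `F` with uniform weights. -/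
theorem F_average_le {M N n : ℕ} (hn : 0 < n) (α : ℝ) (f : Idx M N → ℝ)
    (q : Fin n → Idx M N → ℝ × ℝ) :
    F α f ((1 / (n : ℝ)) • ∑ k, q k) ≤ (1 / (n : ℝ)) * ∑ k, F α f (q k) := by
  have hn' : (0 : ℝ) < n := by exact_mod_cast hn
  simp only [F, normVsq, divOp_smul, divOp_sum, ← Finset.mul_sum]
  rw [Finset.sum_comm, mul_left_comm, Finset.mul_sum (a := 1 / (n : ℝ))]
  refine mul_le_mul_of_nonneg_left (Finset.sum_le_sum fun x _ => ?_) (by norm_num)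
  have h := sq_sum_le_card_mul_sum_sq (s := (Finset.univ : Finset (Fin n)))
    (f := fun k => divOp (q k) x + α * f x)
  simp only [Finset.card_univ, Fintype.card_fin] at h
  have e : ((1 / (n : ℝ)) • ∑ k, divOp (q k)) x + α * f x
      = (1 / (n : ℝ)) * ∑ k, (divOp (q k) x + α * f x) := by
    simp only [Pi.smul_apply, Finset.sum_apply, smul_eq_mul, Finset.sum_add_distrib,
      Finset.sum_const, Finset.card_univ, Fintype.card_fin, nsmul_eq_mul]
    field_simp
  rw [e, mul_pow]
  calc _ ≤ (1 / (n : ℝ)) ^ 2 * (n * ∑ k, (divOp (q k) x + α * f x) ^ 2) := by gcongr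
    _ = _ := by field_simp

/-- A local minimizer decreases `F` by at least half the squared norm of the divergence of
the update. -/
theorem F_local_minimizer_add_le {M N : ℕ} (α : ℝ) (f : Idx M N → ℝ) (S : Finset (Idx M N))
    {p : Idx M N → ℝ × ℝ} (hp : p ∈ Cset M N) {s : {x // x ∈ S} → ℝ × ℝ} (hs : s ∈ Ck S)
    (hmin : ∀ r ∈ Ck S, Fk α f S s p ≤ Fk α f S r p) :
    F α f (Ek S s + (p - projk S p))
      + 1 / 2 * normVsq (divOp (p - (Ek S s + (p - projk S p)))) ≤ F α f p := by
  set q := Ek S s + (p - projk S p) with hqdef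
  have hq : q ∈ Cset M N := Ek_add_sub_projk_mem_Cset S hp hs
  have h := F_add_half_normVsq_le α f q (p - q) fun t ht0 ht1 => by
    have hw : q + t • (p - q) ∈ Cset M N :=
      (convex_Cset M N).add_smul_sub_mem hq hp ⟨ht0, ht1⟩
    have hle := hmin _ ⟨_, hw, rfl⟩
    have e : Ek S (Rk S (q + t • (p - q))) + (p - projk S p) = q + t • (p - q) := by
      funext x
      by_cases hx : x ∈ S <;> simp [hqdef, Ek, Rk, projk, hx]
    simpa only [Fk, e] using hle
  rwa [add_sub_cancel] at h

theorem projk_sub_average {M N n : ℕ} (hn : 0 < n) (S : Fin n → Finset (Idx M N))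
    (hdisj : ∀ k l, k ≠ l → Disjoint (S k) (S l)) (p : Idx M N → ℝ × ℝ)
    (s : ∀ k, {x // x ∈ S k} → ℝ × ℝ) (k : Fin n) :
    projk (S k) (p - (1 / (n : ℝ)) • ∑ l, (Ek (S l) (s l) + (p - projk (S l) p)))
      = (1 / (n : ℝ)) • (p - (Ek (S k) (s k) + (p - projk (S k) p))) := by
  have hn' : (n : ℝ) ≠ 0 := by exact_mod_cast hn.ne'
  funext x
  by_cases hx : x ∈ S k
  · have h1 : ∑ l, (p - (Ek (S l) (s l) + (p - projk (S l) p))) x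
        = (p - (Ek (S k) (s k) + (p - projk (S k) p))) x := by
      refine Finset.sum_eq_single k (fun l _ hl => ?_) (by simp)
      have hx' : x ∉ S l := Finset.disjoint_left.mp (hdisj k l hl.symm) hx
      simp [Ek, projk, hx']
    rw [Pi.smul_apply, ← h1]
    simp only [projk, hx, if_true, Pi.sub_apply, Pi.smul_apply, Finset.sum_apply,
      Finset.sum_sub_distrib, Finset.sum_const, Finset.card_univ, Fintype.card_fin, smul_sub]
    rw [← Nat.cast_smul_eq_nsmul ℝ, smul_smul, one_div_mul_cancel hn', one_smul]
  · simp [projk, Ek, hx]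

theorem relaxed_jacobi_energy_decrease (M N : ℕ) (α : ℝ) (hα : 0 < α) (f : Idx M N → ℝ)
    (Nc : ℕ) (S : Fin Nc → Finset (Idx M N))
    (hdisj : ∀ k l, k ≠ l → Disjoint (S k) (S l))
    (hcover : ∀ x : Idx M N, ∃ k, x ∈ S k)
    (p : ℕ → Idx M N → ℝ × ℝ) (hp0 : p 0 ∈ Cset M N)
    (s : ∀ _ : ℕ, ∀ k : Fin Nc, {x // x ∈ S k} → ℝ × ℝ)
    (hs : ∀ n k, s n k ∈ Ck (S k))
    (hmin : ∀ n k, ∀ rk ∈ Ck (S k),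
      Fk α f (S k) (s n k) (p n) ≤ Fk α f (S k) rk (p n))
    (hrec : ∀ n, p (n + 1) =
      (1 / (Nc : ℝ)) • ∑ k, (Ek (S k) (s n k) + (p n - projk (S k) (p n))))
    : ∀ n, Ddist S (p n) (p (n + 1)) ≤ F α f (p n) - F α f (p (n + 1))
      ∧ 0 ≤ Ddist S (p n) (p (n + 1)) := by
  have hmem : ∀ n, p n ∈ Cset M N := by
    intro n
    induction n with
    | zero => exact hp0
    | succ n ih =>
      rcases Nat.eq_zero_or_pos Nc with rfl | hN
      · intro x
        exact (hcover x).choose.elim0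
      · have hN' : (Nc : ℝ) ≠ 0 := by exact_mod_cast hN.ne'
        rw [hrec n, Finset.smul_sum]
        refine (convex_Cset M N).sum_mem (fun _ _ => by positivity) ?_
          fun k _ => Ek_add_sub_projk_mem_Cset (S k) ih (hs n k)
        simp [hN']
  intro n
  refine ⟨?_, Finset.sum_nonneg fun k _ => mul_nonneg (by norm_num) (normVsq_nonneg _)⟩
  rcases Nat.eq_zero_or_pos Nc with rfl | hN
  · have : IsEmpty (Idx M N) := ⟨fun x => (hcover x).choose.elim0⟩
    simp [Ddist, F, normVsq]
  have hN1 : (1 : ℝ) ≤ Nc := by exact_mod_cast hN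
  have hc1 : 1 / (Nc : ℝ) ≤ 1 := by rw [div_le_one] <;> linarith
  have hc0 : 0 < 1 / (Nc : ℝ) := by positivity
  have havg := F_average_le hN α f fun k => Ek (S k) (s n k) + (p n - projk (S k) (p n))
  have hsum := Finset.sum_le_sum fun k (_ : k ∈ (Finset.univ : Finset (Fin Nc))) =>
    F_local_minimizer_add_le α f (S k) (hmem n) (hs n k) (hmin n k)
  have hnonneg : 0 ≤ ∑ k, 1 / 2 * normVsq
      (divOp (p n - (Ek (S k) (s n k) + (p n - projk (S k) (p n))))) :=
    Finset.sum_nonneg fun k _ => mul_nonneg (by norm_num) (normVsq_nonneg _)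
  have hD : Ddist S (p n) (p (n + 1)) = (1 / (Nc : ℝ)) ^ 2 * ∑ k, 1 / 2 * normVsq
      (divOp (p n - (Ek (S k) (s n k) + (p n - projk (S k) (p n))))) := by
    rw [Ddist, Finset.mul_sum]
    refine Finset.sum_congr rfl fun k _ => ?_
    rw [hrec n, projk_sub_average hN S hdisj, divOp_smul, normVsq_smul]
    ring
  rw [← hrec n] at havg
  rw [Finset.sum_add_distrib, Finset.sum_const, Finset.card_univ, Fintype.card_fin,
    nsmul_eq_mul] at hsum
  have hscaled := mul_le_mul_of_nonneg_left hsum hc0.le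
  rw [mul_add, ← mul_assoc, one_div_mul_cancel (by positivity), one_mul] at hscaled
  have hsq : (1 / (Nc : ℝ)) ^ 2 ≤ 1 / (Nc : ℝ) := by nlinarith
  have hfinal := mul_le_mul_of_nonneg_right hsq hnonneg
  rw [hD]
  linarith
end
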